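/- For the elephant random walk remembering the first two and the most recent step: (i) S_n/n converges in distribution, as n → ∞, to the three-point law S taking the value (2p−1)/(2−p) with probability p², the value 0 with probability 1−p, and the value −(2p−1)/(2−p) with probability p(1−p); (ii) E(S_n/n) → p(2p−1)²/(2−p) and Var(S_n/n) → p(1−p)(2p−1)²(4p²+1)/(2−p)² as n → ∞; (iii) for every r > 0, E((S_n/n)^r) → E(S^r), since |S_n/n| ≤ 1 for all n. -/

import Mathlib

open MeasureTheory ProbabilityTheory Filter Topology

noncomputable section

/-- The σ-algebra generated by the steps `X 1, …, X n`. -/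
def sigmaUpTo {Ω : Type*} (X : ℕ → Ω → ℝ) (n : ℕ) : MeasurableSpace Ω :=
  ⨆ i ∈ Finset.Icc 1 n, MeasurableSpace.comap (X i) inferInstance

/-- The σ-algebra generated by all the steps `X 1, X 2, …`. -/
def sigmaAll {Ω : Type*} (X : ℕ → Ω → ℝ) : MeasurableSpace Ω :=
  ⨆ i ∈ Set.Ici 1, MeasurableSpace.comap (X i) inferInstance

/-- The partial sum `X 1 + ⋯ + X n` of the walk. -/
def partialSum {Ω : Type*} (X : ℕ → Ω → ℝ) (n : ℕ) (ω : Ω) : ℝ :=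
  ∑ k ∈ Finset.Icc 1 n, X k ω

/-- Convergence in distribution of the random variables `f n` to the law `ν`,
expressed as weak convergence tested against bounded continuous functions. -/
def TendstoInDistribution {Ω : Type*} [MeasurableSpace Ω] (μ : Measure Ω)
    (f : ℕ → Ω → ℝ) (ν : Measure ℝ) : Prop :=
  ∀ g : BoundedContinuousFunction ℝ ℝ,
    Tendsto (fun n => ∫ ω, g (f n ω) ∂μ) atTop (𝓝 (∫ x, g x ∂ν))

/-- Testing a random variable against an `m`-measurable one only sees its conditional
expectation given `m`. -/
theorem integral_mul_eq_of_condExp_ae_eq {Ω : Type*} {m mΩ : MeasurableSpace Ω} {μ : Measure Ω}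
    [IsFiniteMeasure μ] (hm : m ≤ mΩ) {f g e : Ω → ℝ} (hg : StronglyMeasurable[m] g)
    (hgf : Integrable (g * f) μ) (hf : Integrable f μ) (he : μ[f | m] =ᵐ[μ] e) :
    ∫ ω, g ω * f ω ∂μ = ∫ ω, g ω * e ω ∂μ := by
  calc ∫ ω, g ω * f ω ∂μ = ∫ ω, (μ[g * f | m]) ω ∂μ := (integral_condExp hm).symm
    _ = ∫ ω, g ω * e ω ∂μ := by
      refine integral_congr_ae ?_
      filter_upwards [condExp_mul_of_stronglyMeasurable_left hg hgf hf, he] with ω h₁ h₂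
      rw [h₁, Pi.mul_apply, h₂]

/-- Mean square convergence of uniformly bounded random variables implies convergence of
the expectations of continuous functions of them. -/
theorem tendsto_integral_comp_of_tendsto_integral_sq_sub {Ω : Type*} [MeasurableSpace Ω]
    {μ : Measure Ω} [IsFiniteMeasure μ] {Z : ℕ → Ω → ℝ} {T : Ω → ℝ} {K : ℝ}
    (hZ : ∀ n, Measurable (Z n))
    (hZK : ∀ n, ∀ᵐ ω ∂μ, |Z n ω| ≤ K)
    (hint : ∀ n, Integrable (fun ω => (Z n ω - T ω) ^ 2) μ)
    (hlim : Tendsto (fun n => ∫ ω, (Z n ω - T ω) ^ 2 ∂μ) atTop (𝓝 0))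
    {h : ℝ → ℝ} (hh : Continuous h) :
    Tendsto (fun n => ∫ ω, h (Z n ω) ∂μ) atTop (𝓝 (∫ ω, h (T ω) ∂μ)) := by
  have hmeasure : TendstoInMeasure μ (fun n ω => (Z n ω - T ω) ^ 2) atTop 0 := by
    refine tendstoInMeasure_of_tendsto_eLpNorm one_ne_zero
      (fun n => (hint n).aestronglyMeasurable) aestronglyMeasurable_zero ?_
    have hnorm (n : ℕ) : eLpNorm ((fun ω => (Z n ω - T ω) ^ 2) - 0) 1 μ
        = ENNReal.ofReal (∫ ω, (Z n ω - T ω) ^ 2 ∂μ) := by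
      rw [sub_zero, eLpNorm_one_eq_lintegral_enorm,
        ofReal_integral_eq_lintegral_ofReal (hint n) (ae_of_all _ fun ω => sq_nonneg _)]
      exact lintegral_congr fun ω => Real.enorm_of_nonneg (sq_nonneg _)
    simp_rw [hnorm]
    simpa using ENNReal.tendsto_ofReal hlim
  obtain ⟨C, hC⟩ := (isCompact_Icc (a := -K) (b := K)).exists_bound_of_continuousOn
    hh.continuousOn
  refine tendsto_of_subseq_tendsto fun ns hns => ?_
  obtain ⟨ms, -, hms⟩ := (hmeasure.comp hns).exists_seq_tendsto_ae
  refine ⟨ms, tendsto_integral_of_dominated_convergence (fun _ => C)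
    (fun n => (hh.measurable.comp (hZ _)).aestronglyMeasurable) (integrable_const C)
    (fun n => ?_) ?_⟩
  · filter_upwards [hZK (ns (ms n))] with ω hω
    exact hC _ (abs_le.mp hω)
  · filter_upwards [hms] with ω hω
    refine (hh.tendsto (T ω)).comp (tendsto_sub_nhds_zero_iff.mp ?_)
    have habs := (Real.continuous_sqrt.tendsto 0).comp hω
    simp only [Function.comp_def, Real.sqrt_sq_eq_abs, Real.sqrt_zero] at habs
    exact (tendsto_zero_iff_abs_tendsto_zero _).mpr habs

section Walk

variable {Ω : Type*} {X : ℕ → Ω → ℝ}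

theorem measurable_sigmaUpTo {i n : ℕ} (hi : i ∈ Finset.Icc 1 n) :
    Measurable[sigmaUpTo X n] (X i) :=
  Measurable.mono (comap_measurable (X i))
    (le_iSup₂ (f := fun i (_ : i ∈ Finset.Icc 1 n) =>
      MeasurableSpace.comap (X i) inferInstance) i hi) le_rfl

theorem measurable_partialSum_sigmaUpTo (n : ℕ) :
    Measurable[sigmaUpTo X n] (partialSum X n) :=
  Finset.measurable_fun_sum _ fun _ hi => measurable_sigmaUpTo hi

theorem partialSum_succ (n : ℕ) (ω : Ω) :
    partialSum X (n + 1) ω = partialSum X n ω + X (n + 1) ω :=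
  Finset.sum_Icc_succ_top (by omega) _

variable [MeasurableSpace Ω] {μ : Measure Ω}

theorem sigmaUpTo_le (hX : ∀ i, Measurable (X i)) (n : ℕ) :
    sigmaUpTo X n ≤ (inferInstance : MeasurableSpace Ω) :=
  iSup₂_le fun i _ => (hX i).comap_le

theorem measurable_partialSum (hX : ∀ i, Measurable (X i)) (n : ℕ) :
    Measurable (partialSum X n) :=
  Finset.measurable_fun_sum _ fun i _ => hX i

theorem ae_abs_partialSum_le (hval : ∀ i, 1 ≤ i → ∀ᵐ ω ∂μ, X i ω = 1 ∨ X i ω = -1) (n : ℕ) :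
    ∀ᵐ ω ∂μ, |partialSum X n ω| ≤ n := by
  induction n with
  | zero => simp [partialSum]
  | succ n ih =>
    filter_upwards [ih, hval (n + 1) (by omega)] with ω h₁ h₂
    rw [partialSum_succ]
    push_cast
    have : |X (n + 1) ω| = 1 := by rcases h₂ with h | h <;> simp [h]
    exact (abs_add_le _ _).trans (by linarith)

theorem memLp_top_step (hX : ∀ i, Measurable (X i))
    (hval : ∀ i, 1 ≤ i → ∀ᵐ ω ∂μ, X i ω = 1 ∨ X i ω = -1) {i : ℕ} (hi : 1 ≤ i) :
    MemLp (X i) ⊤ μ := by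
  refine memLp_top_of_bound (hX i).aestronglyMeasurable 1 ?_
  filter_upwards [hval i hi] with ω h
  rcases h with h | h <;> simp [h]

theorem memLp_top_partialSum (hX : ∀ i, Measurable (X i))
    (hval : ∀ i, 1 ≤ i → ∀ᵐ ω ∂μ, X i ω = 1 ∨ X i ω = -1) (n : ℕ) :
    MemLp (partialSum X n) ⊤ μ :=
  memLp_top_of_bound (measurable_partialSum hX n).aestronglyMeasurable n
    (ae_abs_partialSum_le hval n)

variable [IsProbabilityMeasure μ]

/-- The expectation of a function of `c (X 1 + X 2) / 2`, where `X 1` has mean `a` and `X 2` has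
conditional mean `a X 1`. -/
theorem integral_comp_first_two {a : ℝ} (hX : ∀ i, Measurable (X i))
    (hval : ∀ i, 1 ≤ i → ∀ᵐ ω ∂μ, X i ω = 1 ∨ X i ω = -1)
    (hmean : ∫ ω, X 1 ω ∂μ = a)
    (hcond : μ[X 2 | sigmaUpTo X 1] =ᵐ[μ] fun ω => a * X 1 ω) (c : ℝ) (h : ℝ → ℝ) :
    ∫ ω, h (c / 2 * (X 1 ω + X 2 ω)) ∂μ
      = ((1 + a) / 2) ^ 2 * h c + (1 - a) / 2 * h 0 + (1 + a) / 2 * ((1 - a) / 2) * h (-c) := by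
  have h1 : MemLp (X 1) ⊤ μ := memLp_top_step hX hval le_rfl
  have h2 : MemLp (X 2) ⊤ μ := memLp_top_step hX hval one_le_two
  have h12 : MemLp (X 1 * X 2) ⊤ μ := h2.mul h1
  have i1 := h1.integrable le_top
  have i2 := h2.integrable le_top
  have i12 := h12.integrable le_top
  have hmean2 : ∫ ω, X 2 ω ∂μ = a ^ 2 := by
    rw [← integral_condExp (sigmaUpTo_le hX 1), integral_congr_ae hcond, integral_const_mul, hmean]
    ring
  have hmean12 : ∫ ω, X 1 ω * X 2 ω ∂μ = a := by
    rw [integral_mul_eq_of_condExp_ae_eq (sigmaUpTo_le hX 1)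
      (measurable_sigmaUpTo (by simp)).stronglyMeasurable i12 i2 hcond]
    calc ∫ ω, X 1 ω * (a * X 1 ω) ∂μ = ∫ _, a ∂μ := by
          refine integral_congr_ae ?_
          filter_upwards [hval 1 le_rfl] with ω hω
          rcases hω with hω | hω <;> simp [hω]
      _ = a := by simp
  have hinterp : (fun ω => h (c / 2 * (X 1 ω + X 2 ω))) =ᵐ[μ] fun ω =>
      (h c + h (-c) + 2 * h 0) / 4 + (h c - h (-c)) / 4 * X 1 ω + (h c - h (-c)) / 4 * X 2 ω
        + (h c + h (-c) - 2 * h 0) / 4 * (X 1 * X 2) ω := by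
    filter_upwards [hval 1 le_rfl, hval 2 one_le_two] with ω hω₁ hω₂
    rcases hω₁ with hω₁ | hω₁ <;> rcases hω₂ with hω₂ | hω₂ <;>
      simp only [Pi.mul_apply, hω₁, hω₂] <;> norm_num <;> ring_nf
  rw [integral_congr_ae hinterp, integral_add (by fun_prop) (by fun_prop),
    integral_add (by fun_prop) (by fun_prop), integral_add (by fun_prop) (by fun_prop),
    integral_const_mul, integral_const_mul, integral_const_mul]
  simp only [Pi.mul_apply, hmean, hmean2, hmean12, integral_const, probReal_univ, one_smul]
  ring

/-- The mean square distance of `Sₙ` to `n T`, where `T` is the conditional limit of `Sₙ / n`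
given the first two steps, grows at most linearly. -/
theorem exists_integral_sq_partialSum_sub_le {a : ℝ} (ha : |a| ≤ 1) (hX : ∀ i, Measurable (X i))
    (hval : ∀ i, 1 ≤ i → ∀ᵐ ω ∂μ, X i ω = 1 ∨ X i ω = -1)
    (hcond : ∀ n, 3 ≤ n →
      μ[X (n + 1) | sigmaUpTo X n] =ᵐ[μ] fun ω => a * (X 1 ω + X 2 ω + X n ω) / 3) :
    ∃ K : ℝ, ∀ n : ℕ, 3 ≤ n →
      ∫ ω, (partialSum X n ω - n * (a / (3 - a) * (X 1 ω + X 2 ω))) ^ 2 ∂μ ≤ K + 20 * n := by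
  obtain ⟨ha₁, ha₂⟩ := abs_le.mp ha
  have ha₃ : 0 < 3 - a := by linarith
  set T : Ω → ℝ := fun ω => a / (3 - a) * (X 1 ω + X 2 ω) with hT
  have hTfix (ω : Ω) : (1 - a / 3) * T ω = a / 3 * (X 1 ω + X 2 ω) := by
    simp only [hT]
    field_simp
  let M : ℕ → Ω → ℝ := fun n ω => (1 - a / 3) * (partialSum X n ω - n * T ω) + a / 3 * (X n ω - T ω)
  let e : ℕ → Ω → ℝ := fun n ω => a * (X 1 ω + X 2 ω + X n ω) / 3
  have hMsucc (n : ℕ) (ω : Ω) : M (n + 1) ω = M n ω + (X (n + 1) ω - e n ω) := by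
    simp only [M, e, partialSum_succ]
    push_cast
    linear_combination -hTfix ω
  have hstep {i : ℕ} (hi : 1 ≤ i) : MemLp (X i) ⊤ μ := memLp_top_step hX hval hi
  have hTmem : MemLp T ⊤ μ := ((hstep le_rfl).add (hstep one_le_two)).const_mul _
  have hMmem {n : ℕ} (hn : 1 ≤ n) : MemLp (M n) ⊤ μ :=
    (((memLp_top_partialSum hX hval n).sub (hTmem.const_mul _)).const_mul _).add
      (((hstep hn).sub hTmem).const_mul _)
  have hemem {n : ℕ} (hn : 1 ≤ n) : MemLp (e n) ⊤ μ := by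
    have := (((hstep le_rfl).add (hstep one_le_two)).add (hstep hn)).const_mul (a / 3)
    refine this.ae_eq (ae_of_all _ fun ω => ?_)
    simp only [e, Pi.add_apply]
    ring
  have hsq {f : Ω → ℝ} (hf : MemLp f ⊤ μ) : Integrable (fun ω => f ω ^ 2) μ :=
    (hf.mono_exponent le_top).integrable_sq
  have hprod {f g : Ω → ℝ} (hf : MemLp f ⊤ μ) (hg : MemLp g ⊤ μ) : Integrable (f * g) μ :=
    (hg.mul hf : MemLp (f * g) ⊤ μ).integrable le_top
  have horth {n : ℕ} (hn : 3 ≤ n) : ∫ ω, M n ω * X (n + 1) ω ∂μ = ∫ ω, M n ω * e n ω ∂μ := by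
    have hmeas {i : ℕ} (h₁ : 1 ≤ i) (h₂ : i ≤ n) : Measurable[sigmaUpTo X n] (X i) :=
      measurable_sigmaUpTo (Finset.mem_Icc.mpr ⟨h₁, h₂⟩)
    have hTmeas : Measurable[sigmaUpTo X n] T :=
      ((hmeas le_rfl (by omega)).add (hmeas one_le_two (by omega))).const_mul _
    have hMmeas : Measurable[sigmaUpTo X n] (M n) :=
      (((measurable_partialSum_sigmaUpTo n).sub (hTmeas.const_mul _)).const_mul _).add
        (((hmeas (by omega) le_rfl).sub hTmeas).const_mul _)
    exact integral_mul_eq_of_condExp_ae_eq (sigmaUpTo_le hX n) hMmeas.stronglyMeasurable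
      (hprod (hMmem (by omega)) (hstep (by omega))) ((hstep (by omega)).integrable le_top)
      (hcond n hn)
  have hincr {n : ℕ} (hn : 3 ≤ n) : ∫ ω, M (n + 1) ω ^ 2 ∂μ ≤ (∫ ω, M n ω ^ 2 ∂μ) + 4 := by
    have hD : MemLp (X (n + 1) - e n) ⊤ μ := (hstep (by omega)).sub (hemem (by omega))
    have hDbound : ∫ ω, (X (n + 1) - e n) ω ^ 2 ∂μ ≤ 4 := by
      have hle : ∫ ω, (X (n + 1) - e n) ω ^ 2 ∂μ ≤ ∫ _, (4 : ℝ) ∂μ := by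
        refine integral_mono_ae (hsq hD) (integrable_const _) ?_
        filter_upwards [hval 1 le_rfl, hval 2 one_le_two, hval n (by omega),
          hval (n + 1) (by omega)] with ω h₁ h₂ h₃ h₄
        simp only [Pi.sub_apply, e]
        rcases h₁ with h₁ | h₁ <;> rcases h₂ with h₂ | h₂ <;> rcases h₃ with h₃ | h₃ <;>
          rcases h₄ with h₄ | h₄ <;> rw [h₁, h₂, h₃, h₄] <;> nlinarith
      simpa using hle
    have hM := hMmem (n := n) (by omega)
    have hexpand : ∫ ω, M (n + 1) ω ^ 2 ∂μ
        = ∫ ω, M n ω ^ 2 + 2 * ((M n * X (n + 1)) ω - (M n * e n) ω)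
          + (X (n + 1) - e n) ω ^ 2 ∂μ := by
      refine integral_congr_ae (ae_of_all _ fun ω => ?_)
      simp only [hMsucc, Pi.mul_apply, Pi.sub_apply]
      ring
    have i₁ := hprod hM (hstep (i := n + 1) (by omega))
    have i₂ := hprod hM (hemem (n := n) (by omega))
    have i₃ : Integrable (fun ω => 2 * ((M n * X (n + 1)) ω - (M n * e n) ω)) μ :=
      (i₁.sub i₂).const_mul 2
    have i₄ : Integrable
        (fun ω => M n ω ^ 2 + 2 * ((M n * X (n + 1)) ω - (M n * e n) ω)) μ := (hsq hM).add i₃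
    rw [hexpand, integral_add i₄ (hsq hD), integral_add (hsq hM) i₃, integral_const_mul,
      integral_sub i₁ i₂]
    simp only [Pi.mul_apply, horth hn, sub_self, mul_zero, add_zero]
    linarith
  have hgrowth (n : ℕ) (hn : 3 ≤ n) : ∫ ω, M n ω ^ 2 ∂μ ≤ (∫ ω, M 3 ω ^ 2 ∂μ) + 4 * n := by
    induction n, hn using Nat.le_induction with
    | base => norm_num
    | succ n hn ih =>
      push_cast
      linarith [hincr hn]
  refine ⟨5 * (∫ ω, M 3 ω ^ 2 ∂μ) + 2, fun n hn => ?_⟩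
  have hM := hMmem (n := n) (by omega)
  have hle : ∫ ω, (partialSum X n ω - n * T ω) ^ 2 ∂μ ≤ ∫ ω, 5 * M n ω ^ 2 + 2 ∂μ := by
    refine integral_mono_ae (hsq ((memLp_top_partialSum hX hval n).sub (hTmem.const_mul _)))
      (((hsq hM).const_mul 5).add (integrable_const 2)) ?_
    filter_upwards [hval 1 le_rfl, hval 2 one_le_two, hval n (by omega)] with ω h₁ h₂ h₃
    have hTle : |T ω| ≤ 1 := by
      have hfrac : |a / (3 - a)| ≤ 1 / 2 := by
        rw [abs_div, abs_of_pos ha₃, div_le_iff₀ ha₃]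
        exact abs_le.mpr ⟨by linarith, by linarith⟩
      have hsum : |X 1 ω + X 2 ω| ≤ 2 := by
        rcases h₁ with h₁ | h₁ <;> rcases h₂ with h₂ | h₂ <;> rw [h₁, h₂] <;> norm_num
      rw [hT, abs_mul]
      nlinarith [abs_nonneg (X 1 ω + X 2 ω), abs_nonneg (a / (3 - a))]
    have hXle : |X n ω| ≤ 1 := by rcases h₃ with h₃ | h₃ <;> simp [h₃]
    have hY : |a / 3 * (X n ω - T ω)| ≤ 2 / 3 := by
      have := abs_sub (X n ω) (T ω)
      rw [abs_mul, abs_div, abs_of_pos (by norm_num : (0 : ℝ) < 3)]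
      nlinarith [abs_nonneg (X n ω - T ω)]
    have hMdef : (1 - a / 3) * (partialSum X n ω - n * T ω) = M n ω - a / 3 * (X n ω - T ω) := by
      simp only [M]
      ring
    have hYsq := sq_le_sq' (abs_le.mp hY).1 (abs_le.mp hY).2
    have hcoef : (4 : ℝ) / 9 ≤ (1 - a / 3) ^ 2 := by nlinarith
    have hscaled : 4 / 9 * (partialSum X n ω - n * T ω) ^ 2
        ≤ (M n ω - a / 3 * (X n ω - T ω)) ^ 2 := by
      rw [← hMdef, mul_pow]
      exact mul_le_mul_of_nonneg_right hcoef (sq_nonneg _)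
    nlinarith [sq_nonneg (M n ω + a / 3 * (X n ω - T ω)), sq_nonneg (M n ω)]
  rw [integral_add ((hsq hM).const_mul 5) (integrable_const 2), integral_const_mul] at hle
  simp only [integral_const, probReal_univ, one_smul] at hle
  linarith [hgrowth n hn]

/-- Expectations of continuous functions of `Sₙ / n` converge to those of the conditional limit
given the first two steps. -/
theorem tendsto_integral_comp_partialSum_div {a : ℝ} (ha : |a| ≤ 1) (hX : ∀ i, Measurable (X i))
    (hval : ∀ i, 1 ≤ i → ∀ᵐ ω ∂μ, X i ω = 1 ∨ X i ω = -1)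
    (hcond : ∀ n, 3 ≤ n →
      μ[X (n + 1) | sigmaUpTo X n] =ᵐ[μ] fun ω => a * (X 1 ω + X 2 ω + X n ω) / 3)
    {h : ℝ → ℝ} (hh : Continuous h) :
    Tendsto (fun n : ℕ => ∫ ω, h (partialSum X n ω / n) ∂μ) atTop
      (𝓝 (∫ ω, h (a / (3 - a) * (X 1 ω + X 2 ω)) ∂μ)) := by
  obtain ⟨K, hK⟩ := exists_integral_sq_partialSum_sub_le ha hX hval hcond
  refine tendsto_integral_comp_of_tendsto_integral_sq_sub (K := 1)
    (fun n => (measurable_partialSum hX n).div_const _)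
    (fun n => ?_) (fun n => ?_) ?_ hh
  · filter_upwards [ae_abs_partialSum_le hval n] with ω hω
    rw [abs_div, Nat.abs_cast]
    exact div_le_one_of_le₀ hω n.cast_nonneg
  · have hmem : MemLp (fun ω => partialSum X n ω * (n : ℝ)⁻¹ - a / (3 - a) * (X 1 ω + X 2 ω)) ⊤ μ :=
      ((memLp_top_partialSum hX hval n).mul_const _).sub
        (((memLp_top_step hX hval le_rfl).add (memLp_top_step hX hval one_le_two)).const_mul _)
    simpa only [div_eq_mul_inv] using (hmem.mono_exponent le_top).integrable_sq
  · have hbound : Tendsto (fun n : ℕ => K / (n : ℝ) ^ 2 + 20 / (n : ℝ)) atTop (𝓝 0) := by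
      have h₁ : Tendsto (fun n : ℕ => (n : ℝ) ^ 2) atTop atTop :=
        (tendsto_pow_atTop two_ne_zero).comp tendsto_natCast_atTop_atTop
      simpa using (h₁.const_div_atTop K).add (tendsto_const_div_atTop_nhds_zero_nat 20)
    refine squeeze_zero' (Eventually.of_forall fun n => integral_nonneg fun ω => sq_nonneg _)
      ?_ hbound
    filter_upwards [eventually_ge_atTop 3] with n hn
    have hn₀ : (0 : ℝ) < n := by exact_mod_cast (by omega : 0 < n)
    have hscale : ∫ ω, (partialSum X n ω / n - a / (3 - a) * (X 1 ω + X 2 ω)) ^ 2 ∂μ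
        = ((n : ℝ) ^ 2)⁻¹
          * ∫ ω, (partialSum X n ω - n * (a / (3 - a) * (X 1 ω + X 2 ω))) ^ 2 ∂μ := by
      rw [← integral_const_mul]
      congr with ω
      rw [← inv_pow, ← mul_pow]
      congr 1
      rw [mul_sub, inv_mul_cancel_left₀ hn₀.ne', inv_mul_eq_div]
    rw [hscale]
    calc ((n : ℝ) ^ 2)⁻¹ * _ ≤ ((n : ℝ) ^ 2)⁻¹ * (K + 20 * n) :=
          mul_le_mul_of_nonneg_left (hK n hn) (by positivity)
      _ = K / (n : ℝ) ^ 2 + 20 / (n : ℝ) := by field_simp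

theorem integral_eq_of_measure_eq_one {p : ℝ} (hp : 0 ≤ p) {Y : Ω → ℝ} (hY : Measurable Y)
    (hval : ∀ᵐ ω ∂μ, Y ω = 1 ∨ Y ω = -1) (hinit : μ {ω | Y ω = 1} = ENNReal.ofReal p) :
    ∫ ω, Y ω ∂μ = 2 * p - 1 := by
  have hset : MeasurableSet {ω | Y ω = 1} := hY (measurableSet_singleton 1)
  have hind : Y =ᵐ[μ] fun ω => 2 * {ω | Y ω = 1}.indicator (fun _ => (1 : ℝ)) ω - 1 := by
    filter_upwards [hval] with ω hω
    rcases hω with hω | hω <;> simp [Set.indicator, hω] <;> norm_num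
  rw [integral_congr_ae hind,
    integral_sub (((integrable_const (1 : ℝ)).indicator hset).const_mul 2) (integrable_const 1),
    integral_const_mul, integral_indicator_const _ hset, measureReal_def, hinit,
    ENNReal.toReal_ofReal hp]
  simp

end Walk

/-- for the elephant random walk remembering the first two and the most
recent step: (i) `Sₙ/n` converges in distribution to the three-point law `S` with mass `p²`
at `(2p-1)/(2-p)`, mass `1-p` at `0` and mass `p(1-p)` at `-(2p-1)/(2-p)`;
(ii) `E(Sₙ/n) → p(2p-1)²/(2-p)` and `Var(Sₙ/n) → p(1-p)(2p-1)²(4p²+1)/(2-p)²`;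
(iii) for every `r > 0`, `E((Sₙ/n)^r) → E(S^r)`. -/
theorem elephant_first_two_and_last_step_lln
    {Ω : Type*} [MeasurableSpace Ω] (μ : Measure Ω) [IsProbabilityMeasure μ]
    (p : ℝ) (hp0 : 0 < p) (hp1 : p < 1)
    (X : ℕ → Ω → ℝ)
    (hXmeas : ∀ i, Measurable (X i))
    (hval : ∀ i, 1 ≤ i → ∀ᵐ ω ∂μ, X i ω = 1 ∨ X i ω = -1)
    (hinit : μ {ω | X 1 ω = 1} = ENNReal.ofReal p)
    (hcond1 : μ[X 2 | sigmaUpTo X 1] =ᵐ[μ] fun ω => (2*p-1) * X 1 ω)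
    (hcond2 : μ[X 3 | sigmaUpTo X 2] =ᵐ[μ] fun ω => (2*p-1) * (X 1 ω + X 2 ω) / 2)
    (hcond : ∀ n, 3 ≤ n →
      μ[X (n+1) | sigmaUpTo X n] =ᵐ[μ]
        fun ω => (2*p-1) * (X 1 ω + X 2 ω + X n ω) / 3) :
    TendstoInDistribution μ (fun n ω => partialSum X n ω / n)
      (ENNReal.ofReal (p^2) • Measure.dirac ((2*p-1)/(2-p)) +
        ENNReal.ofReal (1-p) • Measure.dirac 0 +
        ENNReal.ofReal (p*(1-p)) • Measure.dirac (-((2*p-1)/(2-p)))) ∧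
    Tendsto (fun n : ℕ => ∫ ω, partialSum X n ω / n ∂μ) atTop
      (𝓝 (p*(2*p-1)^2/(2-p))) ∧
    Tendsto (fun n : ℕ => variance (fun ω => partialSum X n ω / n) μ) atTop
      (𝓝 (p*(1-p)*(2*p-1)^2*(4*p^2+1)/(2-p)^2)) ∧
    (∀ r : ℕ, 0 < r →
      Tendsto (fun n : ℕ => ∫ ω, (partialSum X n ω / n)^r ∂μ) atTop
        (𝓝 (p^2 * ((2*p-1)/(2-p))^r + (1-p) * (0:ℝ)^r +
          p*(1-p) * (-((2*p-1)/(2-p)))^r))) := by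
  have ha : |2 * p - 1| ≤ 1 := abs_le.mpr ⟨by linarith, by linarith⟩
  have h2p : 2 - p ≠ 0 := by linarith
  have hmean := integral_eq_of_measure_eq_one hp0.le (hXmeas 1) (hval 1 le_rfl) hinit
  have key {h : ℝ → ℝ} (hh : Continuous h) :
      Tendsto (fun n : ℕ => ∫ ω, h (partialSum X n ω / n) ∂μ) atTop
        (𝓝 (p ^ 2 * h ((2 * p - 1) / (2 - p)) + (1 - p) * h 0
          + p * (1 - p) * h (-((2 * p - 1) / (2 - p))))) := by
    have hlim := tendsto_integral_comp_partialSum_div ha hXmeas hval hcond hh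
    have hc : (2 * p - 1) / (3 - (2 * p - 1)) = (2 * p - 1) / (2 - p) / 2 := by
      rw [div_div]
      congr 1
      ring
    rw [hc, integral_comp_first_two hXmeas hval hmean hcond1] at hlim
    convert hlim using 2
    ring
  have hmom (r : ℕ) := key (continuous_pow r)
  have hfirst : Tendsto (fun n : ℕ => ∫ ω, partialSum X n ω / n ∂μ) atTop
      (𝓝 (p * (2 * p - 1) ^ 2 / (2 - p))) := by
    have hone := hmom 1
    simp only [pow_one] at hone
    convert hone using 2
    field_simp
    ring
  refine ⟨fun g => ?_, hfirst, ?_, fun r _ => hmom r⟩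
  · convert key g.continuous using 2
    have hint (x : ℝ) (c : ℝ) : Integrable g (ENNReal.ofReal c • Measure.dirac x) :=
      (g.integrable _).smul_measure ENNReal.ofReal_ne_top
    rw [integral_add_measure ((hint _ _).add_measure (hint _ _)) (hint _ _),
      integral_add_measure (hint _ _) (hint _ _)]
    simp only [integral_smul_measure, integral_dirac, smul_eq_mul]
    rw [ENNReal.toReal_ofReal (by positivity), ENNReal.toReal_ofReal (by linarith),
      ENNReal.toReal_ofReal (mul_nonneg hp0.le (by linarith))]
  · have hvar (n : ℕ) : variance (fun ω => partialSum X n ω / n) μ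
        = (∫ ω, (partialSum X n ω / n) ^ 2 ∂μ) - (∫ ω, partialSum X n ω / n ∂μ) ^ 2 := by
      have hmem := (memLp_top_partialSum hXmeas hval n).mul_const (n : ℝ)⁻¹
      simp only [← div_eq_mul_inv] at hmem
      exact variance_eq_sub (hmem.mono_exponent le_top)
    simp_rw [hvar]
    convert (hmom 2).sub (hfirst.pow 2) using 2
    field_simp
    ring
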